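/- arXiv:1601.06094 — 3 statements merged into one kernel-verified Lean document; each statement's English description precedes it below -/
import Mathlib

section
/- For every Δ ≥ 0: G(R,Δ|P) > 0 whenever 0 ≤ R < R(Δ|P), and G(R,Δ|P) = 0 whenever R ≥ R(Δ|P). -/
open Real Filter

noncomputable section

def IsDist {X : Type*} [Fintype X] (P : X → ℝ) : Prop :=
  (∀ x, 0 ≤ P x) ∧ ∑ x, P x = 1

def IsJoint {X Y : Type*} [Fintype X] [Fintype Y] (q : X → Y → ℝ) : Prop :=
  (∀ x y, 0 ≤ q x y) ∧ ∑ x, ∑ y, q x y = 1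

def IsCond {X Y : Type*} [Fintype X] [Fintype Y] (V : X → Y → ℝ) : Prop :=
  (∀ x y, 0 ≤ V x y) ∧ ∀ x, ∑ y, V x y = 1

def margX {X Y : Type*} [Fintype Y] (q : X → Y → ℝ) (x : X) : ℝ := ∑ y, q x y

def margY {X Y : Type*} [Fintype X] (q : X → Y → ℝ) (y : Y) : ℝ := ∑ x, q x y

/-- conditional distribution of `X` given `Y` : `q_{X|Y}(x|y)` -/
def condXY {X Y : Type*} [Fintype X] (q : X → Y → ℝ) (x : X) (y : Y) : ℝ :=
  q x y / margY q y

/-- conditional distribution of `Y` given `X` : `q_{Y|X}(y|x)` -/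
def condYX {X Y : Type*} [Fintype Y] (q : X → Y → ℝ) (x : X) (y : Y) : ℝ :=
  q x y / margX q x

/-- mutual information `I(q_X, q_{Y|X})` of a joint distribution `q` -/
def mutInfo {X Y : Type*} [Fintype X] [Fintype Y] (q : X → Y → ℝ) : ℝ :=
  ∑ x, ∑ y, q x y * Real.log (q x y / (margX q x * margY q y))

/-- divergence `D(q_X ‖ P)` -/
def klX {X Y : Type*} [Fintype X] [Fintype Y] (q : X → Y → ℝ) (P : X → ℝ) : ℝ :=
  ∑ x, margX q x * Real.log (margX q x / P x)

/-- divergence `D(p ‖ q)` of distributions on `X` -/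
def klD {X : Type*} [Fintype X] (p q : X → ℝ) : ℝ :=
  ∑ x, p x * Real.log (p x / q x)

/-- divergence `D(q ‖ p)` of joint distributions -/
def klJoint {X Y : Type*} [Fintype X] [Fintype Y] (q p : X → Y → ℝ) : ℝ :=
  ∑ x, ∑ y, q x y * Real.log (q x y / p x y)

/-- expected distortion `E_q[d(X,Y)]` -/
def Ed {X Y : Type*} [Fintype X] [Fintype Y] (q d : X → Y → ℝ) : ℝ :=
  ∑ x, ∑ y, q x y * d x y

/-- `G(R,Δ|P)` -/
def G {X Y : Type*} [Fintype X] [Fintype Y] (P : X → ℝ) (d : X → Y → ℝ) (R Δ : ℝ) : ℝ :=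
  sInf {v : ℝ | ∃ q : X → Y → ℝ, IsJoint q ∧ Ed q d ≤ Δ ∧
    v = max 0 (mutInfo q - R) + klX q P}

/-- `G^{(λ)}(R,Δ|P)` -/
def Glam {X Y : Type*} [Fintype X] [Fintype Y] (P : X → ℝ) (d : X → Y → ℝ)
    (lam R Δ : ℝ) : ℝ :=
  sInf {v : ℝ | ∃ q : X → Y → ℝ, IsJoint q ∧ Ed q d ≤ Δ ∧
    v = lam * (mutInfo q - R) + klX q P}

/-- rate distortion function `R(Δ|P)` -/
def RD {X Y : Type*} [Fintype X] [Fintype Y] (P : X → ℝ) (d : X → Y → ℝ) (Δ : ℝ) : ℝ :=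
  sInf {v : ℝ | ∃ V : X → Y → ℝ, IsCond V ∧ Ed (fun x y => P x * V x y) d ≤ Δ ∧
    v = mutInfo (fun x y => P x * V x y)}

/-- `Ω^{(μ,λ)}(P)` -/
def OmegaF {X Y : Type*} [Fintype X] [Fintype Y] (P : X → ℝ) (d : X → Y → ℝ)
    (μ lam : ℝ) : ℝ :=
  sInf {v : ℝ | ∃ q : X → Y → ℝ, IsJoint q ∧
    v = lam * mutInfo q + klX q P + μ * Ed q d}

/-- `G^{(μ,λ)}(R,Δ|P) = Ω^{(μ,λ)}(P) − λR − μΔ` -/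
def Gmulam {X Y : Type*} [Fintype X] [Fintype Y] (P : X → ℝ) (d : X → Y → ℝ)
    (μ lam R Δ : ℝ) : ℝ :=
  OmegaF P d μ lam - lam * R - μ * Δ

/-- `ω_q^{(μ,λ)}(x,y)` -/
def omg {X Y : Type*} [Fintype X] [Fintype Y] (P : X → ℝ) (d : X → Y → ℝ)
    (μ lam : ℝ) (q : X → Y → ℝ) (x : X) (y : Y) : ℝ :=
  Real.log (margX q x ^ (1 - lam) * condXY q x y ^ lam * Real.exp (μ * d x y) / P x)

/-- `F^{(μ,λ)}(p,q) = E_q[ω_p^{(μ,λ)}(X,Y)] + D(q‖p)` -/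
def Ffun {X Y : Type*} [Fintype X] [Fintype Y] (P : X → ℝ) (d : X → Y → ℝ)
    (μ lam : ℝ) (p q : X → Y → ℝ) : ℝ :=
  (∑ x, ∑ y, q x y * omg P d μ lam p x y) + klJoint q p

/-- `Λ_p^{(μ,λ)} = E_p[exp(−ω_p^{(μ,λ)}(X,Y))]` -/
def Lam {X Y : Type*} [Fintype X] [Fintype Y] (P : X → ℝ) (d : X → Y → ℝ)
    (μ lam : ℝ) (p : X → Y → ℝ) : ℝ :=
  ∑ x, ∑ y, p x y * Real.exp (-(omg P d μ lam p x y))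

/-- cutoff rate `R_cut^{(λ)}(Δ|P)` -/
def Rcut {X Y : Type*} [Fintype X] [Fintype Y] (P : X → ℝ) (d : X → Y → ℝ)
    (lam Δ : ℝ) : ℝ :=
  sInf {v : ℝ | ∃ q : X → Y → ℝ, IsJoint q ∧ Ed q d ≤ Δ ∧
    v = mutInfo q + (1 / lam) * klX q P}

/-- Shannon entropy -/
def entropy {X : Type*} [Fintype X] (p : X → ℝ) : ℝ :=
  -∑ x, p x * Real.log (p x)

section RateDistortion

variable {X Y : Type*}

lemma continuous_margX [Fintype Y] (x : X) : Continuous fun q : X → Y → ℝ => margX q x := by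
  unfold margX; fun_prop

lemma continuous_margY [Fintype X] (y : Y) : Continuous fun q : X → Y → ℝ => margY q y := by
  unfold margY; fun_prop

lemma margX_nonneg [Fintype Y] {q : X → Y → ℝ} (hq : ∀ x y, 0 ≤ q x y) (x : X) : 0 ≤ margX q x :=
  Finset.sum_nonneg fun y _ => hq x y

variable [Fintype X] [Fintype Y]

lemma continuous_Ed (d : X → Y → ℝ) : Continuous fun q : X → Y → ℝ => Ed q d := by
  unfold Ed; fun_prop

lemma margX_cond (P : X → ℝ) {V : X → Y → ℝ} (hV : IsCond V) :
    margX (fun x y => P x * V x y) = P := by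
  funext x
  simp [margX, ← Finset.mul_sum, hV.2 x]

/-- Mutual information is the sum of the marginal entropies minus the joint entropy. -/
lemma mutInfo_eq_negMulLog {q : X → Y → ℝ} (hq : ∀ x y, 0 ≤ q x y) :
    mutInfo q = ∑ x, negMulLog (margX q x) + ∑ y, negMulLog (margY q y)
      - ∑ x, ∑ y, negMulLog (q x y) := by
  have hterm : ∀ x y, q x y * Real.log (q x y / (margX q x * margY q y)) =
      q x y * -Real.log (margX q x) + q x y * -Real.log (margY q y) - negMulLog (q x y) := by
    intro x y
    rcases (hq x y).eq_or_lt with h | h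
    · simp [← h]
    · have hx : 0 < margX q x :=
        h.trans_le (Finset.single_le_sum (f := fun y => q x y) (fun y _ => hq x y)
          (Finset.mem_univ y))
      have hy : 0 < margY q y :=
        h.trans_le (Finset.single_le_sum (f := fun x => q x y) (fun x _ => hq x y)
          (Finset.mem_univ x))
      rw [Real.log_div h.ne' (mul_pos hx hy).ne', Real.log_mul hx.ne' hy.ne', negMulLog]
      ring
  have hX : ∀ x, ∑ y, q x y * -Real.log (margX q x) = negMulLog (margX q x) := by
    intro x
    rw [← Finset.sum_mul, negMulLog, margX]
    ring
  have hY : ∀ y, ∑ x, q x y * -Real.log (margY q y) = negMulLog (margY q y) := by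
    intro y
    rw [← Finset.sum_mul, negMulLog, margY]
    ring
  simp only [mutInfo, hterm, Finset.sum_sub_distrib, Finset.sum_add_distrib, hX]
  rw [Finset.sum_comm (f := fun x y => q x y * -Real.log (margY q y))]
  simp only [hY]

lemma continuousOn_mutInfo :
    ContinuousOn (mutInfo : (X → Y → ℝ) → ℝ) {q | ∀ x y, 0 ≤ q x y} := by
  have hcont : Continuous fun q : X → Y → ℝ =>
      ∑ x, negMulLog (margX q x) + ∑ y, negMulLog (margY q y)
        - ∑ x, ∑ y, negMulLog (q x y) := by
    have hX := continuous_margX (X := X) (Y := Y)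
    have hY := continuous_margY (X := X) (Y := Y)
    have hlog := Real.continuous_negMulLog
    fun_prop
  exact hcont.continuousOn.congr fun q hq => mutInfo_eq_negMulLog hq

lemma klX_eq_sum_klFun {P : X → ℝ} (hP : IsDist P) (hPpos : ∀ x, 0 < P x)
    {q : X → Y → ℝ} (hq : IsJoint q) :
    klX q P = ∑ x, P x * InformationTheory.klFun (margX q x / P x) := by
  have hterm : ∀ x, P x * InformationTheory.klFun (margX q x / P x) =
      margX q x * Real.log (margX q x / P x) + (P x - margX q x) := by
    intro x
    have := (hPpos x).ne'
    rw [InformationTheory.klFun]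
    field_simp
    ring
  have hsum : ∑ x, margX q x = 1 := hq.2
  simp only [hterm, Finset.sum_add_distrib, Finset.sum_sub_distrib, hP.2, hsum, klX]
  ring

lemma klX_nonneg {P : X → ℝ} (hP : IsDist P) (hPpos : ∀ x, 0 < P x)
    {q : X → Y → ℝ} (hq : IsJoint q) : 0 ≤ klX q P := by
  rw [klX_eq_sum_klFun hP hPpos hq]
  exact Finset.sum_nonneg fun x _ => mul_nonneg (hP.1 x)
    (InformationTheory.klFun_nonneg (div_nonneg (margX_nonneg hq.1 x) (hP.1 x)))

lemma klX_eq_zero_iff {P : X → ℝ} (hP : IsDist P) (hPpos : ∀ x, 0 < P x)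
    {q : X → Y → ℝ} (hq : IsJoint q) : klX q P = 0 ↔ margX q = P := by
  have hdiv : ∀ x, 0 ≤ margX q x / P x := fun x => div_nonneg (margX_nonneg hq.1 x) (hP.1 x)
  rw [klX_eq_sum_klFun hP hPpos hq, Finset.sum_eq_zero_iff_of_nonneg fun x _ =>
    mul_nonneg (hP.1 x) (InformationTheory.klFun_nonneg (hdiv x)), funext_iff]
  simp [(hPpos _).ne', InformationTheory.klFun_eq_zero_iff (hdiv _), div_eq_one_iff_eq]

lemma continuousOn_klX {P : X → ℝ} (hP : IsDist P) (hPpos : ∀ x, 0 < P x) :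
    ContinuousOn (fun q : X → Y → ℝ => klX q P) {q | IsJoint q} := by
  have hcont : Continuous fun q : X → Y → ℝ =>
      ∑ x, P x * InformationTheory.klFun (margX q x / P x) := by
    have hX := continuous_margX (X := X) (Y := Y)
    have hkl := InformationTheory.continuous_klFun
    fun_prop
  exact hcont.continuousOn.congr fun q hq => klX_eq_sum_klFun hP hPpos hq

lemma isCompact_setOf_isJoint : IsCompact {q : X → Y → ℝ | IsJoint q} := by
  refine (isCompact_Icc (a := (0 : X → Y → ℝ)) (b := 1)).of_isClosed_subset ?_ ?_
  · have h : {q : X → Y → ℝ | IsJoint q} =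
        (⋂ x, ⋂ y, {q | 0 ≤ q x y}) ∩ {q | ∑ x, ∑ y, q x y = 1} := by
      ext q
      simp [IsJoint]
    rw [h]
    exact (isClosed_iInter fun x => isClosed_iInter fun y =>
      isClosed_le (by fun_prop) (by fun_prop)).inter (isClosed_eq (by fun_prop) (by fun_prop))
  · intro q hq
    refine ⟨fun x y => hq.1 x y, fun x y => ?_⟩
    have hxy : q x y ≤ margX q x :=
      Finset.single_le_sum (f := fun y => q x y) (fun y _ => hq.1 x y) (Finset.mem_univ y)
    have hx : margX q x ≤ ∑ x, margX q x :=
      Finset.single_le_sum (fun x _ => margX_nonneg hq.1 x) (Finset.mem_univ x)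
    exact (hxy.trans hx).trans_eq hq.2

lemma isCompact_setOf_isJoint_Ed_le (d : X → Y → ℝ) (Δ : ℝ) :
    IsCompact {q : X → Y → ℝ | IsJoint q ∧ Ed q d ≤ Δ} :=
  isCompact_setOf_isJoint.inter_right (isClosed_le (continuous_Ed d) continuous_const)

/-- The rate distortion function as an infimum over joint distributions with marginal `P`. -/
lemma RD_eq_sInf_image {P : X → ℝ} (hP : IsDist P) (hPpos : ∀ x, 0 < P x)
    (d : X → Y → ℝ) (Δ : ℝ) :
    RD P d Δ = sInf (mutInfo '' {q | (IsJoint q ∧ Ed q d ≤ Δ) ∧ margX q = P}) := by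
  unfold RD
  congr 1
  ext v
  constructor
  · rintro ⟨V, hV, hVd, rfl⟩
    have hm := margX_cond P hV
    refine ⟨_, ⟨⟨⟨fun x y => mul_nonneg (hP.1 x) (hV.1 x y), ?_⟩, hVd⟩, hm⟩, rfl⟩
    exact (Finset.sum_congr rfl fun x _ => congrFun hm x).trans hP.2
  · rintro ⟨q, ⟨⟨hq, hqd⟩, hm⟩, rfl⟩
    have hmul : (fun x y => P x * (q x y / P x)) = q := by
      funext x y
      exact mul_div_cancel₀ _ (hPpos x).ne'
    refine ⟨fun x y => q x y / P x, ⟨fun x y => div_nonneg (hq.1 x y) (hP.1 x), fun x => ?_⟩, ?_⟩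
    · rw [← Finset.sum_div, div_eq_one_iff_eq (hPpos x).ne']
      exact congrFun hm x
    · simp only [hmul, and_true]
      exact hqd

lemma exists_isJoint_Ed_le_margX_eq {P : X → ℝ} (hP : IsDist P) {d : X → Y → ℝ}
    (hd0 : ∀ x, ∃ y, d x y = 0) {Δ : ℝ} (hΔ : 0 ≤ Δ) :
    ∃ q : X → Y → ℝ, (IsJoint q ∧ Ed q d ≤ Δ) ∧ margX q = P := by
  classical
  choose c hc using hd0
  refine ⟨fun x y => if y = c x then P x else 0, ⟨⟨fun x y => ?_, ?_⟩, ?_⟩, ?_⟩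
  · dsimp only
    split_ifs
    exacts [hP.1 x, le_rfl]
  · simpa using hP.2
  · simpa [Ed, hc] using hΔ
  · funext x
    simp [margX]

end RateDistortion

/-- for every `Δ ≥ 0`: `G(R,Δ|P) > 0` whenever `0 ≤ R < R(Δ|P)`,
and `G(R,Δ|P) = 0` whenever `R ≥ R(Δ|P)`. -/
theorem stmt3 {X Y : Type*} [Fintype X] [Fintype Y]
    (P : X → ℝ) (hP : IsDist P) (hPpos : ∀ x, 0 < P x)
    (d : X → Y → ℝ) (hd : ∀ x y, 0 ≤ d x y) (hd0 : ∀ x, ∃ y, d x y = 0) :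
    ∀ Δ : ℝ, 0 ≤ Δ →
      (∀ R : ℝ, 0 ≤ R → R < RD P d Δ → 0 < G P d R Δ) ∧
      (∀ R : ℝ, RD P d Δ ≤ R → G P d R Δ = 0) := by
  intro Δ hΔ
  have hK := isCompact_setOf_isJoint_Ed_le d Δ
  obtain ⟨q₀, hq₀, hm₀⟩ := exists_isJoint_Ed_le_margX_eq hP hd0 hΔ
  have hI : ContinuousOn mutInfo {q : X → Y → ℝ | IsJoint q ∧ Ed q d ≤ Δ} :=
    continuousOn_mutInfo.mono fun q hq => hq.1.1
  have hS : IsCompact {q : X → Y → ℝ | (IsJoint q ∧ Ed q d ≤ Δ) ∧ margX q = P} :=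
    hK.inter_right (isClosed_eq (continuous_pi continuous_margX) continuous_const)
  have hIS : IsCompact
      (mutInfo '' {q : X → Y → ℝ | (IsJoint q ∧ Ed q d ≤ Δ) ∧ margX q = P}) :=
    hS.image_of_continuousOn (hI.mono fun q hq => hq.1)
  have hnonneg : ∀ R, ∀ v ∈ {v : ℝ | ∃ q : X → Y → ℝ, IsJoint q ∧ Ed q d ≤ Δ ∧
      v = max 0 (mutInfo q - R) + klX q P}, 0 ≤ v := by
    rintro R v ⟨q, hq, -, rfl⟩
    exact add_nonneg (le_max_left _ _) (klX_nonneg hP hPpos hq)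
  rw [RD_eq_sInf_image hP hPpos]
  refine ⟨fun R _ hR => ?_, fun R hR => ?_⟩
  · have hcont : ContinuousOn (fun q : X → Y → ℝ => max 0 (mutInfo q - R) + klX q P)
        {q | IsJoint q ∧ Ed q d ≤ Δ} :=
      (continuousOn_const.sup (hI.sub continuousOn_const)).add
        ((continuousOn_klX hP hPpos).mono fun q hq => hq.1)
    obtain ⟨q, ⟨hq, hqd⟩, hmin⟩ := hK.exists_isMinOn ⟨q₀, hq₀⟩ hcont
    have hkl := klX_nonneg hP hPpos hq
    have hpos : 0 < max 0 (mutInfo q - R) + klX q P := by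
      rcases hkl.eq_or_lt with h | h
      · have hle := csInf_le hIS.bddBelow
          ⟨q, ⟨⟨hq, hqd⟩, (klX_eq_zero_iff hP hPpos hq).1 h.symm⟩, rfl⟩
        exact add_pos_of_pos_of_nonneg (lt_max_of_lt_right (by linarith)) hkl
      · exact add_pos_of_nonneg_of_pos (le_max_left _ _) h
    refine hpos.trans_le (le_csInf ⟨_, q₀, hq₀.1, hq₀.2, rfl⟩ ?_)
    rintro v ⟨p, hp, hpd, rfl⟩
    exact hmin ⟨hp, hpd⟩
  · obtain ⟨q, ⟨⟨hq, hqd⟩, hm⟩, hqI⟩ := hIS.sInf_mem ⟨_, q₀, ⟨hq₀, hm₀⟩, rfl⟩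
    refine le_antisymm (csInf_le ⟨0, hnonneg R⟩ ⟨q, hq, hqd, ?_⟩) (Real.sInf_nonneg (hnonneg R))
    rw [(klX_eq_zero_iff hP hPpos hq).2 hm, max_eq_left (by linarith), add_zero]
end
end

section
/- For every joint distribution q on 𝒳×𝒴 and every joint distribution p on 𝒳×𝒴 with all components positive, F^{(μ,λ)}(p,q) = E_q[ω_q^{(μ,λ)}(X,Y)] + (1−λ)·D(q_{Y|X}||p_{Y|X}|q_X) + λ·D(q_Y||p_Y), where D(q_{Y|X}||p_{Y|X}|q_X) = Σ_{x,y} q(x,y) log( q_{Y|X}(y|x)/p_{Y|X}(y|x) ) and D(q_Y||p_Y) = Σ_y q_Y(y) log( q_Y(y)/p_Y(y) ). -/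
open Real Filter

noncomputable section

theorem le_margX {X Y : Type*} [Fintype Y] {q : X → Y → ℝ} (hq : ∀ x y, 0 ≤ q x y)
    (x : X) (y : Y) : q x y ≤ margX q x :=
  Finset.single_le_sum (f := fun y => q x y) (fun y _ => hq x y) (Finset.mem_univ y)

theorem le_margY {X Y : Type*} [Fintype X] {q : X → Y → ℝ} (hq : ∀ x y, 0 ≤ q x y)
    (x : X) (y : Y) : q x y ≤ margY q y :=
  Finset.single_le_sum (f := fun x => q x y) (fun x _ => hq x y) (Finset.mem_univ x)

theorem omg_eq_of_pos {X Y : Type*} [Fintype X] [Fintype Y] {P : X → ℝ} (d : X → Y → ℝ)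
    (μ lam : ℝ) {q : X → Y → ℝ} {x : X} {y : Y} (hP : 0 < P x) (hq : 0 < q x y)
    (hX : 0 < margX q x) (hY : 0 < margY q y) :
    omg P d μ lam q x y =
      (1 - lam) * Real.log (margX q x) + lam * (Real.log (q x y) - Real.log (margY q y))
        + μ * d x y - Real.log (P x) := by
  have hc : 0 < condXY q x y := div_pos hq hY
  rw [omg, Real.log_div (by positivity) hP.ne', Real.log_mul (by positivity) (by positivity),
    Real.log_mul (by positivity) (by positivity), Real.log_rpow hX, Real.log_rpow hc,
    Real.log_exp, condXY, Real.log_div hq.ne' hY.ne']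

theorem sum_margY_mul {X Y : Type*} [Fintype X] [Fintype Y] (q : X → Y → ℝ) (f : Y → ℝ) :
    ∑ y, margY q y * f y = ∑ x, ∑ y, q x y * f y := by
  rw [Finset.sum_comm]
  simp only [margY, Finset.sum_mul]

/-- `F^{(μ,λ)}(p,q) = E_q[ω_q^{(μ,λ)}(X,Y)]
+ (1−λ)·D(q_{Y|X}‖p_{Y|X}|q_X) + λ·D(q_Y‖p_Y)`. -/
theorem stmt10 {X Y : Type*} [Fintype X] [Fintype Y]
    (P : X → ℝ) (hP : IsDist P) (hPpos : ∀ x, 0 < P x)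
    (d : X → Y → ℝ) (hd : ∀ x y, 0 ≤ d x y)
    (μ lam : ℝ) (hμ : 0 ≤ μ) (hlam0 : 0 ≤ lam) (hlam1 : lam ≤ 1) :
    ∀ p q : X → Y → ℝ, IsJoint p → (∀ x y, 0 < p x y) → IsJoint q →
      Ffun P d μ lam p q =
        (∑ x, ∑ y, q x y * omg P d μ lam q x y)
        + (1 - lam) * (∑ x, ∑ y, q x y * Real.log (condYX q x y / condYX p x y))
        + lam * (∑ y, margY q y * Real.log (margY q y / margY p y)) := by
  intro p q _ hp hq
  rw [Ffun, klJoint, sum_margY_mul]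
  simp only [Finset.mul_sum, ← Finset.sum_add_distrib]
  refine Finset.sum_congr rfl fun x _ => Finset.sum_congr rfl fun y _ => ?_
  rcases (hq.1 x y).eq_or_lt with h | h
  · simp [← h]
  have hp0 := hp x y
  have hpX := hp0.trans_le (le_margX (fun x y => (hp x y).le) x y)
  have hpY := hp0.trans_le (le_margY (fun x y => (hp x y).le) x y)
  have hqX := h.trans_le (le_margX hq.1 x y)
  have hqY := h.trans_le (le_margY hq.1 x y)
  rw [omg_eq_of_pos d μ lam (hPpos x) hp0 hpX hpY, omg_eq_of_pos d μ lam (hPpos x) h hqX hqY,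
    condYX, condYX, Real.log_div (div_pos h hqX).ne' (div_pos hp0 hpX).ne',
    Real.log_div h.ne' hqX.ne', Real.log_div hp0.ne' hpX.ne', Real.log_div h.ne' hp0.ne',
    Real.log_div hqY.ne' hpY.ne']
  ring
end
end

section
/- Fix a joint distribution p on 𝒳×𝒴 with all components positive, and define q̂(p)(x,y) = (1/Λ_p^{(μ,λ)}) · P(x) exp(−μ d(x,y)) p(x,y) / ( p_X(x)^{1−λ} p_{X|Y}(x|y)^{λ} ). Then for every joint distribution q on 𝒳×𝒴, F^{(μ,λ)}(p,q) ≥ F^{(μ,λ)}(p, q̂(p)) = −log Λ_p^{(μ,λ)}, with equality when q = q̂(p). -/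
open Real Filter

noncomputable section

/-- the updated distribution `q̂(p)` -/
def qhat {X Y : Type*} [Fintype X] [Fintype Y] (P : X → ℝ) (d : X → Y → ℝ)
    (μ lam : ℝ) (p : X → Y → ℝ) (x : X) (y : Y) : ℝ :=
  (1 / Lam P d μ lam p) *
    (P x * Real.exp (-(μ * d x y)) * p x y /
      (margX p x ^ (1 - lam) * condXY p x y ^ lam))

theorem klJoint_nonneg {X Y : Type*} [Fintype X] [Fintype Y] {q r : X → Y → ℝ}
    (hq : IsJoint q) (hr : IsJoint r) (hrpos : ∀ x y, 0 < r x y) : 0 ≤ klJoint q r := by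
  have pointwise (x : X) (y : Y) : q x y - r x y ≤ q x y * Real.log (q x y / r x y) := by
    rcases (hq.1 x y).eq_or_lt with h | h
    · simpa [← h] using (hrpos x y).le
    · have hlog := Real.one_sub_inv_le_log_of_pos (div_pos h (hrpos x y))
      calc q x y - r x y = q x y * (1 - (q x y / r x y)⁻¹) := by
            have := h.ne'
            field_simp
        _ ≤ _ := mul_le_mul_of_nonneg_left hlog h.le
  calc (0 : ℝ) = ∑ x, ∑ y, (q x y - r x y) := by
        simp [Finset.sum_sub_distrib, hq.2, hr.2]
    _ ≤ klJoint q r :=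
        Finset.sum_le_sum fun x _ => Finset.sum_le_sum fun y _ => pointwise x y

theorem klJoint_self {X Y : Type*} [Fintype X] [Fintype Y] {q : X → Y → ℝ}
    (hq : ∀ x y, 0 < q x y) : klJoint q q = 0 := by
  simp [klJoint, div_self (hq _ _).ne']

theorem IsJoint.nonempty {X Y : Type*} [Fintype X] [Fintype Y] {p : X → Y → ℝ}
    (hp : IsJoint p) : Nonempty X ∧ Nonempty Y := by
  constructor <;> by_contra h <;> rw [not_nonempty_iff] at h <;> simpa using hp.2

theorem Lam_pos {X Y : Type*} [Fintype X] [Fintype Y] (P : X → ℝ) (d : X → Y → ℝ)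
    (μ lam : ℝ) {p : X → Y → ℝ} (hp : IsJoint p) (hppos : ∀ x y, 0 < p x y) :
    0 < Lam P d μ lam p := by
  obtain ⟨_, _⟩ := hp.nonempty
  exact Finset.sum_pos (fun x _ => Finset.sum_pos
    (fun y _ => mul_pos (hppos x y) (Real.exp_pos _)) Finset.univ_nonempty) Finset.univ_nonempty

theorem margX_pos {X Y : Type*} [Fintype Y] [Nonempty Y] {p : X → Y → ℝ}
    (hppos : ∀ x y, 0 < p x y) (x : X) : 0 < margX p x :=
  Finset.sum_pos (fun y _ => hppos x y) Finset.univ_nonempty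

theorem condXY_pos {X Y : Type*} [Fintype X] [Nonempty X] {p : X → Y → ℝ}
    (hppos : ∀ x y, 0 < p x y) (x : X) (y : Y) : 0 < condXY p x y :=
  div_pos (hppos x y) (Finset.sum_pos (fun x _ => hppos x y) Finset.univ_nonempty)

/-- `q̂(p)` is the exponential tilting of `p` by `-ω_p`, normalized by `Λ_p`. -/
theorem qhat_eq_tilt {X Y : Type*} [Fintype X] [Fintype Y] {P : X → ℝ} (hPpos : ∀ x, 0 < P x)
    (d : X → Y → ℝ) (μ lam : ℝ) {p : X → Y → ℝ} (hp : IsJoint p) (hppos : ∀ x y, 0 < p x y)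
    (x : X) (y : Y) :
    qhat P d μ lam p x y = p x y * Real.exp (-(omg P d μ lam p x y)) / Lam P d μ lam p := by
  obtain ⟨_, _⟩ := hp.nonempty
  have hm := Real.rpow_pos_of_pos (margX_pos hppos x) (1 - lam)
  have hc := Real.rpow_pos_of_pos (condXY_pos hppos x y) lam
  have hP := hPpos x
  have hL := Lam_pos P d μ lam hp hppos
  rw [qhat, omg, Real.exp_neg (Real.log _), Real.exp_log (by positivity), Real.exp_neg]
  field_simp

theorem qhat_pos {X Y : Type*} [Fintype X] [Fintype Y] {P : X → ℝ} (hPpos : ∀ x, 0 < P x)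
    (d : X → Y → ℝ) (μ lam : ℝ) {p : X → Y → ℝ} (hp : IsJoint p) (hppos : ∀ x y, 0 < p x y)
    (x : X) (y : Y) : 0 < qhat P d μ lam p x y := by
  rw [qhat_eq_tilt hPpos d μ lam hp hppos]
  exact div_pos (mul_pos (hppos x y) (Real.exp_pos _)) (Lam_pos P d μ lam hp hppos)

theorem isJoint_qhat {X Y : Type*} [Fintype X] [Fintype Y] {P : X → ℝ} (hPpos : ∀ x, 0 < P x)
    (d : X → Y → ℝ) (μ lam : ℝ) {p : X → Y → ℝ} (hp : IsJoint p) (hppos : ∀ x y, 0 < p x y) :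
    IsJoint (qhat P d μ lam p) := by
  refine ⟨fun x y => (qhat_pos hPpos d μ lam hp hppos x y).le, ?_⟩
  simp_rw [qhat_eq_tilt hPpos d μ lam hp hppos, ← Finset.sum_div]
  exact div_self (Lam_pos P d μ lam hp hppos).ne'

/-- `F(p,q) = D(q ‖ q̂(p)) − log Λ_p`. -/
theorem Ffun_eq_klJoint_qhat {X Y : Type*} [Fintype X] [Fintype Y] {P : X → ℝ}
    (hPpos : ∀ x, 0 < P x) (d : X → Y → ℝ) (μ lam : ℝ) {p q : X → Y → ℝ} (hp : IsJoint p)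
    (hppos : ∀ x y, 0 < p x y) (hq : IsJoint q) :
    Ffun P d μ lam p q =
      klJoint q (qhat P d μ lam p) - Real.log (Lam P d μ lam p) := by
  have hL := Lam_pos P d μ lam hp hppos
  have pointwise (x : X) (y : Y) :
      q x y * omg P d μ lam p x y + q x y * Real.log (q x y / p x y) =
        q x y * Real.log (q x y / qhat P d μ lam p x y) -
          q x y * Real.log (Lam P d μ lam p) := by
    rcases eq_or_ne (q x y) 0 with h | h
    · simp [h]
    · have hpxy := (hppos x y).ne'
      rw [Real.log_div h hpxy, Real.log_div h (qhat_pos hPpos d μ lam hp hppos x y).ne',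
        qhat_eq_tilt hPpos d μ lam hp hppos,
        Real.log_div (mul_ne_zero hpxy (Real.exp_ne_zero _)) hL.ne',
        Real.log_mul hpxy (Real.exp_ne_zero _), Real.log_exp]
      ring
  simp only [Ffun, klJoint, ← Finset.sum_add_distrib, pointwise, Finset.sum_sub_distrib,
    ← Finset.sum_mul, hq.2, one_mul]

/-- Lemma 4: for fixed positive `p`, `F^{(μ,λ)}(p,q)` is minimized
by `q = q̂(p)`, with minimum value `−log Λ_p^{(μ,λ)}`. -/
theorem stmt11 {X Y : Type*} [Fintype X] [Fintype Y]
    (P : X → ℝ) (hP : IsDist P) (hPpos : ∀ x, 0 < P x)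
    (d : X → Y → ℝ) (hd : ∀ x y, 0 ≤ d x y)
    (μ lam : ℝ) (hμ : 0 ≤ μ) (hlam0 : 0 ≤ lam) (hlam1 : lam ≤ 1)
    (p : X → Y → ℝ) (hp : IsJoint p) (hppos : ∀ x y, 0 < p x y) :
    (∀ q : X → Y → ℝ, IsJoint q →
      Ffun P d μ lam p (qhat P d μ lam p) ≤ Ffun P d μ lam p q) ∧
    Ffun P d μ lam p (qhat P d μ lam p) = -Real.log (Lam P d μ lam p) := by
  have hqhat := isJoint_qhat hPpos d μ lam hp hppos
  have hself : Ffun P d μ lam p (qhat P d μ lam p) = -Real.log (Lam P d μ lam p) := by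
    rw [Ffun_eq_klJoint_qhat hPpos d μ lam hp hppos hqhat,
      klJoint_self (qhat_pos hPpos d μ lam hp hppos), zero_sub]
  refine ⟨fun q hq => ?_, hself⟩
  rw [hself, Ffun_eq_klJoint_qhat hPpos d μ lam hp hppos hq]
  linarith [klJoint_nonneg hq hqhat (qhat_pos hPpos d μ lam hp hppos)]
end
end
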